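/- Let N, M ≥ 1, let q ∈ ℂ with 0 < |q| < 1, and let a_1,…,a_M, b_1,…,b_N, x_1,…,x_M ∈ ℂ, γ_1,…,γ_N ∈ ℂ, with b_j ∉ q^ℤ, x_M ∉ q^{ℤ} ∪ q^{ℤ+1}, a_M x_M ∉ q^{ℤ} ∪ q^{ℤ+1}, x_i ∉ q^ℤ and a_i x_i ∉ q^ℤ for all i, j. Set ν_j = γ_j − γ_{j+1} (γ_{N+1} = 0), β = ∏_{j=1}^N b_j, and assume a_M x_M − β ≠ 0. For n ∈ ℤ^N put u_j = q^{n_j} (u_0 = 1) and Φ(n) = ∏_{j=1}^N u_j^{ν_j} (q u_j/u_{j−1};q)_∞/(b_j u_j/u_{j−1};q)_∞ · ∏_{i=1}^M (a_i x_i u_N;q)_∞/(x_i u_N;q)_∞. Define Ψ_0 = Σ_{n ∈ ℤ^N} Φ(n) and, for 1 ≤ j ≤ N, Ψ̂_j = Σ_{n ∈ ℤ^N} Φ(n)(u_{j−1} − b_j u_j)/(1 − a_M x_M u_N), assuming absolute summability of all families involved (including after the shift x_M → q x_M). Then Ψ_0 evaluated at x_M replaced by q x_M equals [(x_M − β)/(a_M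 x_M − β)] Ψ_0 + [(a_M − 1)x_M/(a_M x_M − β)] Σ_{j=1}^N (∏_{k=1}^{j−1} b_k) Ψ̂_j. -/

import Mathlib

noncomputable def qPochInf (q a : ℂ) : ℂ := ∏' i : ℕ, (1 - q ^ i * a)

/-- The exponent of `u_{j-1}`: `n_{j-1}`, with the convention `u_0 = q^0 = 1`. -/
def nprev {N : ℕ} (n : Fin N → ℤ) (j : Fin N) : ℤ :=
  if h : 0 < (j : ℕ) then n ⟨(j : ℕ) - 1, Nat.lt_of_le_of_lt (Nat.sub_le _ _) j.isLt⟩ else 0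

/-- The exponent of `u_N = q^{n_N}` (the last coordinate). -/
def nlast {N : ℕ} (n : Fin N → ℤ) : ℤ :=
  if h : 0 < N then n ⟨N - 1, Nat.sub_lt h one_pos⟩ else 0

/-- `ν_j = γ_j − γ_{j+1}` with `γ_{N+1} = 0`. -/
def nuOf {N : ℕ} (γ : Fin N → ℂ) (j : Fin N) : ℂ :=
  γ j - if h : (j : ℕ) + 1 < N then γ ⟨(j : ℕ) + 1, h⟩ else 0

/-- The integrand `Φ(n) = ∏_j u_j^{ν_j} (q u_j/u_{j−1};q)_∞/(b_j u_j/u_{j−1};q)_∞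
· ∏_i (a_i x_i u_N;q)_∞/(x_i u_N;q)_∞` evaluated at `u_j = q^{n_j}`, with
`u_j^{ν_j} = exp(ν_j n_j Log q)`. -/
noncomputable def PhiInt (q : ℂ) {N M : ℕ} (γ b : Fin N → ℂ) (a x : Fin M → ℂ)
    (n : Fin N → ℤ) : ℂ :=
  (∏ j : Fin N, Complex.exp (nuOf γ j * (n j : ℂ) * Complex.log q) *
      (qPochInf q (q ^ (n j - nprev n j + 1)) /
        qPochInf q (b j * q ^ (n j - nprev n j)))) *
  ∏ i : Fin M, qPochInf q (a i * x i * q ^ nlast n) / qPochInf q (x i * q ^ nlast n)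

/-- `p_{j,i}(n) = (u_{j−1} − b_j u_j)/(1 − a_i x_i u_N) ·
∏_{k<i} (1 − x_k u_N)/(1 − a_k x_k u_N)` at `u_j = q^{n_j}`. -/
noncomputable def pInt (q : ℂ) {N M : ℕ} (b : Fin N → ℂ) (a x : Fin M → ℂ)
    (j : Fin N) (i : Fin M) (n : Fin N → ℤ) : ℂ :=
  (q ^ nprev n j - b j * q ^ n j) / (1 - a i * x i * q ^ nlast n) *
  ∏ k ∈ Finset.Iio i, (1 - x k * q ^ nlast n) / (1 - a k * x k * q ^ nlast n)

/-- `Ψ_{j,i} = Σ_{n ∈ ℤ^N} Φ(n) p_{j,i}(n)` (bilateral Jackson sum). -/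
noncomputable def PsiJI (q : ℂ) {N M : ℕ} (γ b : Fin N → ℂ) (a x : Fin M → ℂ)
    (j : Fin N) (i : Fin M) : ℂ :=
  ∑' n : Fin N → ℤ, PhiInt q γ b a x n * pInt q b a x j i n

theorem qPochInf_eq_one_sub_mul {q : ℂ} (hq : ‖q‖ < 1) (z : ℂ) :
    qPochInf q z = (1 - z) * qPochInf q (q * z) := by
  have hm : Multipliable fun i : ℕ => 1 - q ^ (i + 1) * z := by
    have hs : Summable fun i : ℕ => ‖-(q ^ (i + 1) * z)‖ := by
      have h := ((summable_geometric_of_lt_one (norm_nonneg q) hq).mul_right (‖q‖ * ‖z‖))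
      refine h.congr fun i => ?_
      rw [norm_neg, norm_mul, norm_pow]
      ring
    simpa only [sub_eq_add_neg] using multipliable_one_add_of_summable hs
  unfold qPochInf
  rw [tprod_eq_zero_mul' (f := fun i : ℕ => 1 - q ^ i * z) hm, pow_zero, one_mul]
  congr 2
  ext i
  ring

/-- The weighted differences `(∏_{k<j} b_k) (u_{j-1} - b_j u_j)` telescope. -/
theorem sum_prod_Iio_mul_sub {N : ℕ} (hN : 0 < N) (q : ℂ) (b : Fin N → ℂ) (n : Fin N → ℤ) :
    ∑ j : Fin N, (∏ k ∈ Finset.Iio j, b k) * (q ^ nprev n j - b j * q ^ n j) =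
      1 - (∏ j, b j) * q ^ nlast n := by
  let F : ℕ → ℂ := fun i => (∏ k ∈ Finset.univ.filter fun k : Fin N => (k : ℕ) < i, b k) *
    q ^ (if h : 0 < i ∧ i - 1 < N then n ⟨i - 1, h.2⟩ else 0)
  have hterm (j : Fin N) : (∏ k ∈ Finset.Iio j, b k) * (q ^ nprev n j - b j * q ^ n j) =
      F j - F (j + 1) := by
    have h1 : Finset.Iio j = Finset.univ.filter fun k : Fin N => (k : ℕ) < j := by
      ext k; simp
    have h2 : (Finset.univ.filter fun k : Fin N => (k : ℕ) < j + 1) =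
        insert j (Finset.Iio j) := by
      ext k
      simp only [Finset.mem_filter, Finset.mem_univ, true_and, Finset.mem_insert,
        Finset.mem_Iio, Fin.lt_def, Fin.ext_iff]
      omega
    have h3 : nprev n j =
        if h : 0 < (j : ℕ) ∧ (j : ℕ) - 1 < N then n ⟨(j : ℕ) - 1, h.2⟩ else 0 := by
      have := j.isLt
      unfold nprev
      split_ifs <;> first | rfl | omega
    have h4 : (if h : 0 < (j : ℕ) + 1 ∧ (j : ℕ) + 1 - 1 < N then n ⟨(j : ℕ) + 1 - 1, h.2⟩
        else 0) = n j :=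
      dif_pos ⟨Nat.succ_pos _, j.isLt⟩
    simp only [F]
    rw [h2, ← h1, Finset.prod_insert (by simp), h4, ← h3]
    ring
  have h0 : F 0 = 1 := by simp [F]
  have hNN : F N = (∏ j, b j) * q ^ nlast n := by
    have h : N - 1 < N := by omega
    simp [F, nlast, hN]
  rw [Finset.sum_congr rfl fun j _ => hterm j,
    Fin.sum_univ_eq_sum_range (fun i => F i - F (i + 1)), Finset.sum_range_sub', h0, hNN]

theorem PhiInt_update_mul {q : ℂ} (hq : ‖q‖ < 1) {N M : ℕ} (γ b : Fin N → ℂ)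
    (a x : Fin M → ℂ) (i : Fin M) (n : Fin N → ℤ)
    (hx : 1 - x i * q ^ nlast n ≠ 0) (hax : 1 - a i * x i * q ^ nlast n ≠ 0) :
    PhiInt q γ b a (Function.update x i (q * x i)) n =
      PhiInt q γ b a x n * ((1 - x i * q ^ nlast n) / (1 - a i * x i * q ^ nlast n)) := by
  unfold PhiInt
  rw [mul_assoc]
  congr 1
  rw [← Finset.mul_prod_erase _ _ (Finset.mem_univ i),
    ← Finset.mul_prod_erase Finset.univ
      (fun k => qPochInf q (a k * x k * q ^ nlast n) / qPochInf q (x k * q ^ nlast n))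
      (Finset.mem_univ i)]
  have hrest : ∏ k ∈ Finset.univ.erase i,
      qPochInf q (a k * Function.update x i (q * x i) k * q ^ nlast n) /
        qPochInf q (Function.update x i (q * x i) k * q ^ nlast n) =
      ∏ k ∈ Finset.univ.erase i,
        qPochInf q (a k * x k * q ^ nlast n) / qPochInf q (x k * q ^ nlast n) :=
    Finset.prod_congr rfl fun k hk => by
      rw [Function.update_of_ne (Finset.ne_of_mem_erase hk)]
  rw [hrest, Function.update_self, qPochInf_eq_one_sub_mul hq (a i * x i * q ^ nlast n),
    qPochInf_eq_one_sub_mul hq (x i * q ^ nlast n),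
    show a i * (q * x i) * q ^ nlast n = q * (a i * x i * q ^ nlast n) by ring,
    show q * x i * q ^ nlast n = q * (x i * q ^ nlast n) by ring, mul_div_mul_comm]
  have hcancel : (1 - a i * x i * q ^ nlast n) / (1 - x i * q ^ nlast n) *
      ((1 - x i * q ^ nlast n) / (1 - a i * x i * q ^ nlast n)) = 1 := by
    rw [div_mul_div_cancel₀ hx, div_self hax]
  generalize ∏ k ∈ Finset.univ.erase i,
    qPochInf q (a k * x k * q ^ nlast n) / qPochInf q (x k * q ^ nlast n) = s
  linear_combination -(qPochInf q (q * (a i * x i * q ^ nlast n)) /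
    qPochInf q (q * (x i * q ^ nlast n)) * s) * hcancel

theorem one_sub_mul_zpow_ne_zero {q z : ℂ} (hz : ∀ m : ℤ, z ≠ q ^ m) (m : ℤ) :
    1 - z * q ^ m ≠ 0 := by
  intro h
  refine hz (-m) ?_
  rw [zpow_neg]
  exact eq_inv_of_mul_eq_one_left (sub_eq_zero.mp h).symm

/-- the first q-shift relation of the Pfaffian system:
`T_{x_M}(Ψ_0) = [(x_M − β)/(a_M x_M − β)] Ψ_0
  + [(a_M − 1)x_M/(a_M x_M − β)] Σ_j (∏_{k<j} b_k) Ψ̂_j`,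
where `Ψ_0 = Σ_{n ∈ ℤ^N} Φ(n)`,
`Ψ̂_j = Σ_{n ∈ ℤ^N} Φ(n)(u_{j−1} − b_j u_j)/(1 − a_M x_M u_N)`, and `Mi` is the
last index (so `x Mi = x_M`, `a Mi = a_M`). -/
theorem stmt12 (N M : ℕ) (hN : 1 ≤ N) (hM : 1 ≤ M) (q : ℂ)
    (hq0 : 0 < ‖q‖) (hq1 : ‖q‖ < 1)
    (a x : Fin M → ℂ) (b γ : Fin N → ℂ)
    (hb : ∀ j : Fin N, ∀ m : ℤ, b j ≠ q ^ m)
    (Mi : Fin M) (hMi : (Mi : ℕ) + 1 = M)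
    (hxM : ∀ m : ℤ, x Mi ≠ q ^ m ∧ x Mi ≠ q ^ (m + 1))
    (haxM : ∀ m : ℤ, a Mi * x Mi ≠ q ^ m ∧ a Mi * x Mi ≠ q ^ (m + 1))
    (hx : ∀ i : Fin M, ∀ m : ℤ, x i ≠ q ^ m)
    (hax : ∀ i : Fin M, ∀ m : ℤ, a i * x i ≠ q ^ m)
    (hβ : a Mi * x Mi - (∏ j, b j) ≠ 0)
    (hsum0 : Summable (fun n : Fin N → ℤ => PhiInt q γ b a x n))
    (hsum0' : Summable (fun n : Fin N → ℤ =>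
      PhiInt q γ b a (Function.update x Mi (q * x Mi)) n))
    (hsumj : ∀ j : Fin N, Summable (fun n : Fin N → ℤ =>
      PhiInt q γ b a x n *
        ((q ^ nprev n j - b j * q ^ n j) / (1 - a Mi * x Mi * q ^ nlast n)))) :
    (∑' n : Fin N → ℤ, PhiInt q γ b a (Function.update x Mi (q * x Mi)) n) =
      ((x Mi - ∏ j, b j) / (a Mi * x Mi - ∏ j, b j)) *
        (∑' n : Fin N → ℤ, PhiInt q γ b a x n) +
      ((a Mi - 1) * x Mi / (a Mi * x Mi - ∏ j, b j)) *
        ∑ j : Fin N, (∏ k ∈ Finset.Iio j, b k) *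
          ∑' n : Fin N → ℤ, PhiInt q γ b a x n *
            ((q ^ nprev n j - b j * q ^ n j) / (1 - a Mi * x Mi * q ^ nlast n)) := by
  simp_rw [← tsum_mul_left]
  rw [← Summable.tsum_finsetSum fun j _ => (hsumj j).mul_left _, ← tsum_mul_left,
    ← (hsum0.mul_left _).tsum_add ((summable_sum fun j _ => (hsumj j).mul_left _).mul_left _)]
  refine tsum_congr fun n => ?_
  have hxn := one_sub_mul_zpow_ne_zero (hx Mi) (nlast n)
  have haxn := one_sub_mul_zpow_ne_zero (hax Mi) (nlast n)
  have htel : ∑ j : Fin N, (∏ k ∈ Finset.Iio j, b k) * (PhiInt q γ b a x n *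
      ((q ^ nprev n j - b j * q ^ n j) / (1 - a Mi * x Mi * q ^ nlast n))) =
      PhiInt q γ b a x n *
        ((1 - (∏ j, b j) * q ^ nlast n) / (1 - a Mi * x Mi * q ^ nlast n)) := by
    rw [← sum_prod_Iio_mul_sub hN, Finset.sum_div, Finset.mul_sum]
    exact Finset.sum_congr rfl fun j _ => by ring
  rw [PhiInt_update_mul hq1 γ b a x Mi n hxn haxn, htel, sub_one_mul]
  generalize PhiInt q γ b a x n = Φ, ∏ j, b j = β at *
  generalize q ^ nlast n = u at *
  generalize a Mi * x Mi = y at *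
  rw [mul_comm y u] at *
  field_simp
  ring
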